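/- (Theorem 7.2(i), case ν = 2: Virasoro relations for the extended r-reduced KP hierarchy.) Let r ≥ 3 be an integer. For an integer j ≥ −1 define the ℂ-linear operator V_{2,j} : R → R by V_{2,j} f = (1/(2r)) · Σ_{a ∈ ℤ} :p_a p_{rj−a}:(f) + ((rj + r + 2)/(2r)) · p_{rj}(f) + δ_{j,0} · ((r² + 12r + 11)/(24r)) · f, where the sum over a ∈ ℤ is the finite sum (finsum) of the finitely many nonzero terms. Then for all integers j, k ≥ −1 with j + k ≥ −1 and every f ∈ R: V_{2,j}(V_{2,k} f) − V_{2,k}(V_{2,j} f) = (j − k) · V_{2,j+k} f. -/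

import Mathlib

open MvPolynomial

/-- The operator `p_a` on `R = MvPolynomial ℕ ℂ`: for `a > 0` the partial
derivative with respect to `X_{a-1}` (i.e. the time variable `t_a`), for
`a < 0` multiplication by `(-a)·X_{-a-1}`, and `p_0 = 0`. -/
noncomputable def pOp (a : ℤ) : MvPolynomial ℕ ℂ → MvPolynomial ℕ ℂ :=
  if 0 < a then fun f => pderiv (a - 1).toNat f
  else if a < 0 then fun f => (((-a : ℤ) : ℂ)) • (X ((-a - 1).toNat) * f)
  else fun _ => 0

/-- The normal-ordered product `:p_a p_b:`. -/
noncomputable def nord (a b : ℤ) : MvPolynomial ℕ ℂ → MvPolynomial ℕ ℂ :=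
  if 0 < a ∧ b < 0 then pOp b ∘ pOp a else pOp a ∘ pOp b

/-- The Virasoro operator `V_{2,j}` of the extended `r`-reduced KP hierarchy:
`V_{2,j} f = (1/(2r))·Σ_{a ∈ ℤ} :p_a p_{rj-a}:(f)
  + ((rj+r+2)/(2r))·p_{rj}(f) + δ_{j,0}·((r²+12r+11)/(24r))·f`. -/
noncomputable def V2r (r : ℤ) (j : ℤ) (f : MvPolynomial ℕ ℂ) : MvPolynomial ℕ ℂ :=
  (1 / (2 * (r : ℂ))) • (∑ᶠ a : ℤ, nord a (r * j - a) f)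
    + ((((r * j + r + 2 : ℤ) : ℂ)) / (2 * (r : ℂ))) • pOp (r * j) f
    + (if j = 0 then
        (((r : ℂ) ^ 2 + 12 * (r : ℂ) + 11) / (24 * (r : ℂ))) • f else 0)

theorem pOp_of_pos {a : ℤ} (h : 0 < a) (f : MvPolynomial ℕ ℂ) :
    pOp a f = pderiv (a - 1).toNat f := by
  simp [pOp, h]

theorem pOp_of_neg {a : ℤ} (h : a < 0) (f : MvPolynomial ℕ ℂ) :
    pOp a f = ((-a : ℤ) : ℂ) • (X ((-a - 1).toNat) * f) := by
  simp [pOp, h, h.not_gt]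

theorem pOp_zero (f : MvPolynomial ℕ ℂ) : pOp 0 f = 0 := by
  simp [pOp]

/-- `pOp a` as a linear endomorphism. -/
noncomputable def pEnd (a : ℤ) : Module.End ℂ (MvPolynomial ℕ ℂ) where
  toFun := pOp a
  map_add' f g := by
    rcases lt_trichotomy a 0 with h | rfl | h
    · simp only [pOp_of_neg h, mul_add, smul_add]
    · simp [pOp_zero]
    · simp only [pOp_of_pos h, map_add]
  map_smul' c f := by
    rcases lt_trichotomy a 0 with h | rfl | h
    · simp only [pOp_of_neg h, mul_smul_comm, RingHom.id_apply, smul_comm c]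
    · simp [pOp_zero]
    · simp only [pOp_of_pos h, Derivation.map_smul, RingHom.id_apply]

theorem pEnd_apply (a : ℤ) (f : MvPolynomial ℕ ℂ) : pEnd a f = pOp a f := rfl

theorem pEnd_of_pos {a : ℤ} (h : 0 < a) (f : MvPolynomial ℕ ℂ) :
    pEnd a f = pderiv (a - 1).toNat f := pOp_of_pos h f

theorem pEnd_of_neg {a : ℤ} (h : a < 0) (f : MvPolynomial ℕ ℂ) :
    pEnd a f = ((-a : ℤ) : ℂ) • (X ((-a - 1).toNat) * f) := pOp_of_neg h f

theorem pEnd_zero (f : MvPolynomial ℕ ℂ) : pEnd 0 f = 0 := pOp_zero f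

theorem map_C_mul (A : Module.End ℂ (MvPolynomial ℕ ℂ)) (c : ℂ) (f : MvPolynomial ℕ ℂ) :
    A (C c * f) = C c * A f := by
  rw [← smul_eq_C_mul, LinearMap.map_smul, smul_eq_C_mul]

theorem pderiv_pderiv_comm (i j : ℕ) (f : MvPolynomial ℕ ℂ) :
    pderiv i (pderiv j f) = pderiv j (pderiv i f) := by
  rcases eq_or_ne i j with rfl | h
  · rfl
  ext m
  simp only [coeff_pderiv, Finsupp.add_apply, Finsupp.single_eq_of_ne h,
    Finsupp.single_eq_of_ne h.symm, add_right_comm m (Finsupp.single i 1)]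
  push_cast
  ring

theorem pEnd_commutator_pos_neg {a b : ℤ} (ha : 0 < a) (hb : b < 0) (f : MvPolynomial ℕ ℂ) :
    pEnd a (pEnd b f) = pEnd b (pEnd a f) + C (if a + b = 0 then (a : ℂ) else 0) * f := by
  simp only [pEnd_of_pos ha, pEnd_of_neg hb, smul_eq_C_mul, pderiv_mul, pderiv_C]
  split_ifs with h
  · obtain rfl : b = -a := by lia
    simp only [neg_neg, pderiv_X_self]
    ring
  · rw [pderiv_X_of_ne (by lia), C_0]
    ring

/-- The Heisenberg commutation relations. -/
theorem pEnd_commutator (a b : ℤ) (f : MvPolynomial ℕ ℂ) :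
    pEnd a (pEnd b f) = pEnd b (pEnd a f) + C (if a + b = 0 then (a : ℂ) else 0) * f := by
  rcases lt_trichotomy a 0 with ha | rfl | ha
  · rcases lt_trichotomy b 0 with hb | rfl | hb
    · rw [if_neg (by lia), C_0]
      simp only [pEnd_of_neg ha, pEnd_of_neg hb, smul_eq_C_mul]
      ring
    · rw [if_neg (by lia)]
      simp [pEnd_zero]
    · rw [pEnd_commutator_pos_neg hb ha, add_comm b a]
      split_ifs with h
      · obtain rfl : b = -a := by lia
        push_cast
        rw [C_neg]
        ring
      · rw [C_0]
        ring
  · simp [pEnd_zero]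
  · rcases lt_trichotomy b 0 with hb | rfl | hb
    · exact pEnd_commutator_pos_neg ha hb f
    · rw [if_neg (by lia)]
      simp [pEnd_zero]
    · rw [if_neg (by lia), C_0, zero_mul, add_zero]
      simp only [pEnd_of_pos ha, pEnd_of_pos hb]
      exact pderiv_pderiv_comm _ _ _

theorem exists_pEnd_apply_eq_zero (f : MvPolynomial ℕ ℂ) :
    ∃ N : ℤ, 0 ≤ N ∧ ∀ a, N < a → pEnd a f = 0 := by
  obtain ⟨M, hM⟩ := f.vars.exists_nat_subset_range
  refine ⟨M, by positivity, fun a ha => ?_⟩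
  rw [pEnd_of_pos (by lia)]
  refine pderiv_eq_zero_of_notMem_vars fun h => ?_
  have := Finset.mem_range.1 (hM h)
  lia

/-- `nord a b` as a linear endomorphism. -/
noncomputable def nordEnd (a b : ℤ) : Module.End ℂ (MvPolynomial ℕ ℂ) :=
  if 0 < a ∧ b < 0 then pEnd b * pEnd a else pEnd a * pEnd b

theorem nordEnd_apply (a b : ℤ) (f : MvPolynomial ℕ ℂ) : nordEnd a b f = nord a b f := by
  unfold nordEnd nord
  split_ifs <;> rfl

theorem finite_support_nordEnd (n : ℤ) (f : MvPolynomial ℕ ℂ) :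
    (Function.support fun a => nordEnd a (n - a) f).Finite := by
  obtain ⟨N, hN, h⟩ := exists_pEnd_apply_eq_zero f
  refine (Set.finite_Icc (-(N + |n|)) (N + |n|)).subset fun a ha => ?_
  by_contra hout
  refine ha ?_
  have h1 := neg_abs_le n
  have h2 := le_abs_self n
  rw [Set.mem_Icc] at hout
  by_cases hp : N + |n| < a
  · simp only [nordEnd]
    rw [if_pos (by lia), Module.End.mul_apply, h a (by lia), map_zero]
  · simp only [nordEnd]
    rw [if_neg (by lia), Module.End.mul_apply, h (n - a) (by lia), map_zero]

theorem nordEnd_commutator_pEnd (a b m : ℤ) (f : MvPolynomial ℕ ℂ) :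
    nordEnd a b (pEnd m f) - pEnd m (nordEnd a b f) =
      (if b = -m then C (-(m : ℂ)) * pEnd a f else 0) +
        if a = -m then C (-(m : ℂ)) * pEnd b f else 0 := by
  have key (a b : ℤ) : pEnd a (pEnd b (pEnd m f)) - pEnd m (pEnd a (pEnd b f)) =
      (if b = -m then C (-(m : ℂ)) * pEnd a f else 0) +
        if a = -m then C (-(m : ℂ)) * pEnd b f else 0 := by
    rw [pEnd_commutator b m f, map_add, map_C_mul, pEnd_commutator a m]
    simp only [← eq_neg_iff_add_eq_zero]
    have hcast (c : ℤ) (g : MvPolynomial ℕ ℂ) : C (if c = -m then (c : ℂ) else 0) * g =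
        if c = -m then C (-(m : ℂ)) * g else 0 := by
      split_ifs with h
      · rw [h, Int.cast_neg]
      · rw [C_0, zero_mul]
    rw [hcast, hcast]
    ring
  simp only [nordEnd]
  by_cases h : 0 < a ∧ b < 0
  · rw [if_pos h, Module.End.mul_apply, Module.End.mul_apply, key, add_comm]
  · rw [if_neg h, Module.End.mul_apply, Module.End.mul_apply, key]

/-- The endomorphism `∑ₐ :p_a p_{n-a}:`, twice the `n`-th Virasoro generator of the free boson. -/
noncomputable def nordSum (n : ℤ) : Module.End ℂ (MvPolynomial ℕ ℂ) where
  toFun f := ∑ᶠ a : ℤ, nordEnd a (n - a) f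
  map_add' f g := by
    simp only [map_add]
    exact finsum_add_distrib (finite_support_nordEnd n f) (finite_support_nordEnd n g)
  map_smul' c f := by
    simp only [map_smul, RingHom.id_apply, smul_finsum]

theorem nordSum_apply (n : ℤ) (f : MvPolynomial ℕ ℂ) :
    nordSum n f = ∑ᶠ a : ℤ, nordEnd a (n - a) f := rfl

theorem nordSum_commutator_pEnd (n m : ℤ) (f : MvPolynomial ℕ ℂ) :
    nordSum n (pEnd m f) = pEnd m (nordSum n f) + C (-2 * m : ℂ) * pEnd (n + m) f := by
  have hfin := finite_support_nordEnd n f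
  have hterm (a : ℤ) : nordEnd a (n - a) (pEnd m f) - pEnd m (nordEnd a (n - a) f) =
      (if a = n + m then C (-(m : ℂ)) * pEnd (n + m) f else 0) +
        if a = -m then C (-(m : ℂ)) * pEnd (n + m) f else 0 := by
    rw [nordEnd_commutator_pEnd]
    congr 1
    · by_cases h : a = n + m
      · rw [if_pos h, if_pos (by lia), h]
      · rw [if_neg h, if_neg (by lia)]
    · split_ifs with h
      · rw [h, sub_neg_eq_add]
      · rfl
  have hsingle (b : ℤ) (g : MvPolynomial ℕ ℂ) :
      (Function.support fun a : ℤ => if a = b then g else 0).Finite :=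
    (Set.finite_singleton b).subset fun a ha => by
      by_contra h
      exact ha (if_neg h)
  have hmap : pEnd m (nordSum n f) = ∑ᶠ a : ℤ, pEnd m (nordEnd a (n - a) f) :=
    AddMonoidHom.map_finsum (pEnd m).toAddMonoidHom hfin
  rw [← sub_eq_iff_eq_add', hmap, nordSum_apply,
    ← finsum_sub_distrib (finite_support_nordEnd n _)
      (hfin.subset fun a ha h => ha (by simp only [h, map_zero])),
    finsum_congr hterm, finsum_add_distrib (hsingle _ _) (hsingle _ _), finsum_eq_single _ (n + m),
    finsum_eq_single _ (-m), if_pos rfl, if_pos rfl, ← add_mul, ← C_add]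
  · ring_nf
  · exact fun a ha => if_neg ha
  · exact fun a ha => if_neg ha

theorem pEnd_one_of_nonneg {a : ℤ} (h : 0 ≤ a) : pEnd a 1 = 0 := by
  rcases h.eq_or_lt with rfl | h
  · exact pEnd_zero 1
  · rw [pEnd_of_pos h, pderiv_one]

theorem constantCoeff_pEnd_of_nonpos {a : ℤ} (h : a ≤ 0) (f : MvPolynomial ℕ ℂ) :
    constantCoeff (pEnd a f) = 0 := by
  rcases h.eq_or_lt with rfl | h
  · rw [pEnd_zero, map_zero]
  · rw [pEnd_of_neg h, smul_eq_C_mul, map_mul, map_mul, constantCoeff_X, zero_mul, mul_zero]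

theorem constantCoeff_pEnd_one (a : ℤ) : constantCoeff (pEnd a 1) = 0 := by
  rcases le_total a 0 with h | h
  · exact constantCoeff_pEnd_of_nonpos h 1
  · rw [pEnd_one_of_nonneg h, map_zero]

theorem constantCoeff_pEnd_pEnd_one {a b : ℤ} (hb : b < 0) :
    constantCoeff (pEnd a (pEnd b 1)) = if a + b = 0 then (a : ℂ) else 0 := by
  rw [pEnd_commutator, map_add, constantCoeff_pEnd_of_nonpos hb.le, zero_add, mul_one,
    constantCoeff_C]

theorem nordEnd_one_of_not_neg {a b : ℤ} (h : ¬(a < 0 ∧ b < 0)) : nordEnd a b 1 = 0 := by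
  simp only [nordEnd]
  split_ifs with hab
  · rw [Module.End.mul_apply, pEnd_one_of_nonneg hab.1.le, map_zero]
  · rw [Module.End.mul_apply]
    rcases le_or_gt 0 b with hb | hb
    · rw [pEnd_one_of_nonneg hb, map_zero]
    · obtain rfl : a = 0 := by lia
      exact pEnd_zero _

theorem nordSum_one (n : ℤ) :
    nordSum n 1 = ∑ a ∈ Finset.Ioo n 0, pEnd a (pEnd (n - a) 1) := by
  rw [nordSum_apply, finsum_eq_sum_of_support_subset (s := Finset.Ioo n 0)]
  · refine Finset.sum_congr rfl fun a ha => ?_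
    rw [Finset.mem_Ioo] at ha
    simp only [nordEnd]
    rw [if_neg (by lia), Module.End.mul_apply]
  · intro a ha
    by_contra h
    rw [Finset.mem_coe, Finset.mem_Ioo] at h
    exact ha (nordEnd_one_of_not_neg (by lia))

theorem constantCoeff_nordSum_one (n : ℤ) : constantCoeff (nordSum n 1) = 0 := by
  rw [nordSum_one, map_sum]
  exact Finset.sum_eq_zero fun a ha =>
    constantCoeff_pEnd_of_nonpos (Finset.mem_Ioo.1 ha).2.le _

theorem eq_C_of_pderiv_eq_zero {f : MvPolynomial ℕ ℂ} (h : ∀ i, pderiv i f = 0) :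
    f = C (constantCoeff f) := by
  ext m
  rw [coeff_C]
  split_ifs with hm
  · rw [← hm]; rfl
  · obtain ⟨i, hi⟩ : ∃ i, m i ≠ 0 := by
      by_contra! hzero
      exact hm (Finsupp.ext fun i => (hzero i).symm)
    have hle : Finsupp.single i 1 ≤ m := by
      rw [Finsupp.single_le_iff]
      lia
    have hcoeff := coeff_pderiv (i := i) f (m - Finsupp.single i 1)
    rw [h i, coeff_zero, tsub_add_cancel_of_le hle] at hcoeff
    exact (mul_eq_zero.1 hcoeff.symm).resolve_right (Nat.cast_add_one_ne_zero _)

/-- Schur's lemma for the Heisenberg algebra acting on the Fock space `MvPolynomial ℕ ℂ`. -/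
theorem eq_C_mul_of_commute_pEnd {D : Module.End ℂ (MvPolynomial ℕ ℂ)}
    (hD : ∀ a f, D (pEnd a f) = pEnd a (D f)) (f : MvPolynomial ℕ ℂ) :
    D f = C (constantCoeff (D 1)) * f := by
  have hX (i : ℕ) (g : MvPolynomial ℕ ℂ) : D (X i * g) = X i * D g := by
    have h := hD (-(i + 1 : ℤ)) g
    have hi : (i + 1 : ℂ) ≠ 0 := Nat.cast_add_one_ne_zero i
    simp only [pEnd_of_neg (show -(i + 1 : ℤ) < 0 by lia), smul_eq_C_mul, map_C_mul] at h
    simpa [hi, ← C_1, ← C_add, -map_add, -map_one, ← map_natCast (C : ℂ →+* MvPolynomial ℕ ℂ)]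
      using h
  have hone : D 1 = C (constantCoeff (D 1)) := by
    refine eq_C_of_pderiv_eq_zero fun i => ?_
    have h := hD (i + 1) 1
    rw [pEnd_of_pos (by lia), pEnd_of_pos (by lia), pderiv_one, map_zero] at h
    simpa using h.symm
  rw [← hone]
  induction f using MvPolynomial.induction_on with
  | C c => rw [← mul_one (C c), map_C_mul]; ring
  | add p q hp hq => rw [map_add, hp, hq]; ring
  | mul_X p i hp => rw [mul_comm, hX, hp]; ring

/-- The coefficient of the linear term of `V2r r j`. -/
noncomputable def linearCoeff (r j : ℤ) : ℂ := ((r * j + r + 2 : ℤ) : ℂ) / (2 * (r : ℂ))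

/-- The constant term of `V2r r 0`. -/
noncomputable def vacuumCoeff (r : ℤ) : ℂ := ((r : ℂ) ^ 2 + 12 * (r : ℂ) + 11) / (24 * (r : ℂ))

/-- `V2r r j` as a linear endomorphism. -/
noncomputable def virasoroEnd (r j : ℤ) : Module.End ℂ (MvPolynomial ℕ ℂ) where
  toFun f := C (1 / (2 * (r : ℂ))) * nordSum (r * j) f + C (linearCoeff r j) * pEnd (r * j) f +
    C (if j = 0 then vacuumCoeff r else 0) * f
  map_add' f g := by
    simp only [map_add]
    ring
  map_smul' c f := by
    simp only [smul_eq_C_mul, map_C_mul, RingHom.id_apply]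
    ring

theorem virasoroEnd_apply (r j : ℤ) (f : MvPolynomial ℕ ℂ) :
    virasoroEnd r j f = C (1 / (2 * (r : ℂ))) * nordSum (r * j) f +
      C (linearCoeff r j) * pEnd (r * j) f + C (if j = 0 then vacuumCoeff r else 0) * f := rfl

theorem V2r_eq_virasoroEnd (r j : ℤ) (f : MvPolynomial ℕ ℂ) : V2r r j f = virasoroEnd r j f := by
  simp only [V2r, virasoroEnd_apply, smul_eq_C_mul, nordSum_apply, nordEnd_apply, pEnd_apply]
  split_ifs
  · rfl
  · rw [C_0, zero_mul]
    rfl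

theorem virasoroEnd_commutator_pEnd {r : ℤ} (hr : (r : ℂ) ≠ 0) (j a : ℤ) (f : MvPolynomial ℕ ℂ) :
    virasoroEnd r j (pEnd a f) = pEnd a (virasoroEnd r j f) + C (-(a / r : ℂ)) * pEnd (r * j + a) f
      + C (if r * j + a = 0 then linearCoeff r j * (r * j) else 0) * f := by
  have hscalar : (C (1 / (2 * (r : ℂ))) * C (-2 * a : ℂ) : MvPolynomial ℕ ℂ) = C (-(a / r : ℂ)) := by
    rw [← C_mul]
    congr 1
    field_simp
  have hif : (C (linearCoeff r j) * C (if r * j + a = 0 then ((r * j : ℤ) : ℂ) else 0) :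
        MvPolynomial ℕ ℂ) =
      C (if r * j + a = 0 then linearCoeff r j * (r * j) else 0) := by
    rw [← C_mul]
    congr 1
    split_ifs
    · push_cast; ring
    · ring
  rw [virasoroEnd_apply, virasoroEnd_apply, nordSum_commutator_pEnd, pEnd_commutator (r * j) a,
    ← hscalar, ← hif]
  simp only [map_add, map_C_mul]
  ring

/-- The defect of the Virasoro relation for `j` and `k`. -/
noncomputable def virasoroDefect (r j k : ℤ) : Module.End ℂ (MvPolynomial ℕ ℂ) where
  toFun f := virasoroEnd r j (virasoroEnd r k f) - virasoroEnd r k (virasoroEnd r j f) -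
    C ((j - k : ℤ) : ℂ) * virasoroEnd r (j + k) f
  map_add' f g := by
    simp only [map_add]
    ring
  map_smul' c f := by
    simp only [smul_eq_C_mul, map_C_mul, RingHom.id_apply]
    ring

theorem virasoroDefect_apply (r j k : ℤ) (f : MvPolynomial ℕ ℂ) :
    virasoroDefect r j k f = virasoroEnd r j (virasoroEnd r k f) -
      virasoroEnd r k (virasoroEnd r j f) - C ((j - k : ℤ) : ℂ) * virasoroEnd r (j + k) f := rfl

theorem virasoroDefect_commute_pEnd {r : ℤ} (hr : (r : ℂ) ≠ 0) (j k a : ℤ)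
    (f : MvPolynomial ℕ ℂ) :
    virasoroDefect r j k (pEnd a f) = pEnd a (virasoroDefect r j k f) := by
  have hp : C (-(a / r : ℂ)) * C (-((r * k + a : ℤ) / r : ℂ))
      - C (-(a / r : ℂ)) * C (-((r * j + a : ℤ) / r : ℂ))
      = (C ((j - k : ℤ) : ℂ) * C (-(a / r : ℂ)) : MvPolynomial ℕ ℂ) := by
    simp only [← C_mul, ← C_sub]
    congr 1
    push_cast
    field_simp
    ring
  have hc : C (-(a / r : ℂ)) * C (if r * j + (r * k + a) = 0 then linearCoeff r j * (r * j) else 0)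
      - C (-(a / r : ℂ)) * C (if r * k + (r * j + a) = 0 then linearCoeff r k * (r * k) else 0)
      = (C ((j - k : ℤ) : ℂ) * C (if r * (j + k) + a = 0 then
          linearCoeff r (j + k) * (r * (j + k : ℤ)) else 0) : MvPolynomial ℕ ℂ) := by
    simp only [← C_mul, ← C_sub]
    congr 1
    by_cases h : r * (j + k) + a = 0
    · rw [if_pos (by linarith), if_pos (by linarith), if_pos h]
      obtain rfl : a = -(r * (j + k)) := by linarith
      simp only [linearCoeff]
      push_cast
      field_simp
      ring
    · rw [if_neg fun h' => h (by linarith), if_neg fun h' => h (by linarith), if_neg h]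
      ring
  simp only [virasoroDefect_apply, virasoroEnd_commutator_pEnd hr, map_add, map_sub, map_C_mul]
  rw [show r * k + (r * j + a) = r * j + (r * k + a) by ring,
    show r * (j + k) + a = r * j + (r * k + a) by ring] at *
  linear_combination pEnd (r * j + (r * k + a)) f * hp + f * hc

theorem virasoroEnd_one_of_nonneg {r j : ℤ} (h : 0 ≤ r * j) :
    virasoroEnd r j 1 = C (if j = 0 then vacuumCoeff r else 0) := by
  rw [virasoroEnd_apply, nordSum_one, Finset.Ioo_eq_empty (by lia), Finset.sum_empty,
    pEnd_one_of_nonneg h, mul_zero, mul_zero, mul_one, zero_add, zero_add]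

theorem constantCoeff_virasoroEnd_one (r j : ℤ) :
    constantCoeff (virasoroEnd r j 1) = if j = 0 then vacuumCoeff r else 0 := by
  rw [virasoroEnd_apply, mul_one]
  simp only [map_add, map_mul, constantCoeff_C, constantCoeff_nordSum_one, constantCoeff_pEnd_one]
  ring

theorem sum_Ioo_neg_mul_add (n : ℕ) (c : ℂ) :
    ∑ a ∈ Finset.Ioo (-(n + 1 : ℤ)) 0, (a : ℂ) * (a + c) =
      n * (n + 1) * (2 * n + 1) / 6 - c * (n * (n + 1) / 2) := by
  induction n with
  | zero =>
    rw [Finset.sum_eq_zero fun a ha => by rw [Finset.mem_Ioo] at ha; lia]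
    simp
  | succ n ih =>
    have hinsert : Finset.Ioo (-((n + 1 : ℕ) + 1 : ℤ)) 0 =
        insert (-(n + 1 : ℤ)) (Finset.Ioo (-(n + 1 : ℤ)) 0) := by
      ext a
      simp only [Finset.mem_insert, Finset.mem_Ioo]
      lia
    rw [hinsert, Finset.sum_insert (by simp), ih]
    push_cast
    ring

theorem constantCoeff_virasoroEnd_virasoroEnd_neg_one {r j : ℤ} (hr : 0 < r) :
    constantCoeff (virasoroEnd r j (virasoroEnd r (-1) 1)) =
      if j = 1 then 2 * vacuumCoeff r else 0 := by
  have hr0 : (r : ℂ) ≠ 0 := by exact_mod_cast hr.ne'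
  have hj (b : ℤ) : r * j + b + (r * -1 - b) = 0 ↔ j = 1 := by
    rw [show r * j + b + (r * -1 - b) = r * (j - 1) by ring, mul_eq_zero, sub_eq_zero]
    simp [hr.ne']
  have hj' : r * j + r * -1 = 0 ↔ j = 1 := by simpa using hj 0
  have hquadratic : constantCoeff (virasoroEnd r j (nordSum (r * -1) 1)) =
      if j = 1 then ((r : ℂ) ^ 2 - 1) / 6 else 0 := by
    have hterm : ∀ a ∈ Finset.Ioo (r * -1) 0,
        constantCoeff (virasoroEnd r j (pEnd a (pEnd (r * -1 - a) 1))) =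
          if j = 1 then -(1 / r : ℂ) * (a * (a + r)) else 0 := fun a ha => by
      rw [Finset.mem_Ioo] at ha
      rw [virasoroEnd_commutator_pEnd hr0]
      simp only [map_add, map_mul, constantCoeff_C, constantCoeff_pEnd_of_nonpos ha.2.le,
        constantCoeff_pEnd_pEnd_one (show r * -1 - a < 0 by lia), constantCoeff_pEnd_one, hj]
      split_ifs with h <;> simp [h] <;> ring
    rw [nordSum_one, map_sum, map_sum, Finset.sum_congr rfl hterm]
    split_ifs
    · rw [← Finset.mul_sum]
      obtain ⟨n, rfl⟩ : ∃ n : ℕ, r = n + 1 := ⟨(r - 1).toNat, by lia⟩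
      rw [mul_neg_one, sum_Ioo_neg_mul_add]
      push_cast at hr0 ⊢
      field_simp
      ring
    · exact Finset.sum_const_zero
  rw [virasoroEnd_apply r (-1), if_neg (by lia), C_0, zero_mul, add_zero, map_add, map_C_mul,
    map_C_mul, virasoroEnd_commutator_pEnd hr0]
  simp only [map_add, map_mul, constantCoeff_C, hquadratic, constantCoeff_pEnd_one,
    constantCoeff_pEnd_of_nonpos (show r * -1 ≤ 0 by lia), map_one, hj']
  split_ifs with h
  · subst h
    simp only [linearCoeff, vacuumCoeff]
    push_cast
    field_simp
    ring
  · ring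

theorem constantCoeff_virasoroDefect_one {r j k : ℤ} (hr : 0 < r) (hk : -1 ≤ k) (hkj : k < j) :
    constantCoeff (virasoroDefect r j k 1) = 0 := by
  have hj0 : 0 ≤ r * j := mul_nonneg hr.le (by lia)
  simp only [virasoroDefect_apply, map_sub, map_mul, constantCoeff_C,
    constantCoeff_virasoroEnd_one]
  rw [virasoroEnd_one_of_nonneg hj0, ← mul_one (C _), map_C_mul, map_mul, constantCoeff_C,
    constantCoeff_virasoroEnd_one]
  rcases hk.eq_or_lt with rfl | hk
  · rw [constantCoeff_virasoroEnd_virasoroEnd_neg_one hr]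
    by_cases h : j = 1
    · subst h
      norm_num
    · rw [if_neg h, if_neg (show ¬(-1 : ℤ) = 0 by lia), if_neg (show ¬j + -1 = 0 by lia)]
      ring
  · rw [virasoroEnd_one_of_nonneg (mul_nonneg hr.le (by lia)), ← mul_one (C _), map_C_mul, map_mul,
      constantCoeff_C, constantCoeff_virasoroEnd_one, if_neg (show ¬j + k = 0 by lia)]
    ring

theorem virasoroEnd_commutator {r j k : ℤ} (hr : 0 < r) (hk : -1 ≤ k) (hkj : k < j)
    (f : MvPolynomial ℕ ℂ) :
    virasoroEnd r j (virasoroEnd r k f) - virasoroEnd r k (virasoroEnd r j f) =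
      C ((j - k : ℤ) : ℂ) * virasoroEnd r (j + k) f := by
  have hr0 : (r : ℂ) ≠ 0 := by exact_mod_cast hr.ne'
  have h := eq_C_mul_of_commute_pEnd (virasoroDefect_commute_pEnd hr0 j k) f
  rw [constantCoeff_virasoroDefect_one hr hk hkj, C_0, zero_mul, virasoroDefect_apply] at h
  exact sub_eq_zero.1 h

/-- Theorem 7.2(i), case ν = 2: for `r ≥ 3` the operators
`V_{2,j}`, `j ≥ -1`, satisfy the Virasoro commutation relations
`[V_{2,j}, V_{2,k}] = (j - k)·V_{2,j+k}`. -/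
theorem virasoro_extended_rKP_nu_two (r : ℤ) (hr : 3 ≤ r) :
    ∀ j k : ℤ, -1 ≤ j → -1 ≤ k → -1 ≤ j + k → ∀ f : MvPolynomial ℕ ℂ,
      V2r r j (V2r r k f) - V2r r k (V2r r j f)
        = ((j - k : ℤ) : ℂ) • V2r r (j + k) f := by
  intro j k hj hk _ f
  have hr0 : 0 < r := by lia
  simp only [V2r_eq_virasoroEnd, smul_eq_C_mul]
  rcases lt_trichotomy j k with h | rfl | h
  · rw [← neg_sub, virasoroEnd_commutator hr0 hj h, add_comm k j, ← neg_mul, ← C_neg,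
      ← Int.cast_neg, neg_sub]
  · simp
  · exact virasoroEnd_commutator hr0 hk h f
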